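/- Let ∇ be the Levi-Civita connection of the Sasaki metric G on the tangent bundle TM of a Finsler manifold (M,F). Then ∇_{δ̄/δ̄x^a} L = 0, ∇_L(δ̄/δ̄x^a) = L(E_a^i) E_d^k g_{ik} g^{de} δ̄/δ̄x^e, ∇_ξ ξ = 0, ∇_ξ L = 0, ∇_L ξ = ξ, ∇_L L = L, and the L-component of ∇_{∂̄/∂̄y^a}(∂̄/∂̄y^b) equals −(1/F²) g_{ab} L, where g_{ab} = g_{ij} E_a^i E_b^j. -/

import Mathlib

/-!
A local-coordinate framework for the geometry of the tangent bundle `TM` of an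
`n`-dimensional Finsler manifold `(M, F)`, following the paper
"A frame on tangent bundle of a Finsler manifold and the natural foliations".

All geometric objects are described through their components on a chart domain
`U` of `TM` (avoiding the zero section): a point `p : Pt n` is the pair of
coordinates `(x^i, y^i)`, and a vector field on `TM` is given by its
components in the natural frame `(∂/∂x^i, ∂/∂y^i)`.
-/

open scoped BigOperators

noncomputable section

namespace FinslerFoliations

/-- A point of the tangent bundle `TM` in local coordinates:
`p.1 = (x^i)` is the base point and `p.2 = (y^i)` is the fibre coordinate. -/
abbrev Pt (n : ℕ) : Type := (Fin n → ℝ) × (Fin n → ℝ)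

/-- A (local) vector field on `TM`, given by its components in the natural
frame: `(X p).1 i` is the coefficient of `∂/∂x^i` and `(X p).2 i` the one of
`∂/∂y^i`. -/
abbrev VF (n : ℕ) : Type := Pt n → Pt n

variable {n : ℕ}

/-- The coordinate vector `∂/∂x^i`. -/
def ex (i : Fin n) : Pt n := (Pi.single i 1, 0)

/-- The coordinate vector `∂/∂y^i`. -/
def ey (i : Fin n) : Pt n := (0, Pi.single i 1)

/-- Partial derivative of a scalar function in the constant direction `v`. -/
def pd (v : Pt n) (f : Pt n → ℝ) (p : Pt n) : ℝ := fderiv ℝ f p v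

/-- Derivative of a scalar function along a vector field. -/
def Dv (X : VF n) (f : Pt n → ℝ) (p : Pt n) : ℝ := fderiv ℝ f p (X p)

/-- The Lie bracket of two vector fields, in coordinates. -/
def lie (X Y : VF n) : VF n := fun p => fderiv ℝ Y p (X p) - fderiv ℝ X p (Y p)

/-- Local-coordinate data of an `n`-dimensional Finsler manifold `(M, F)` on a
chart domain `U ⊆ TM` avoiding the zero section: the fundamental function `F`
(smooth, positive and positively `1`-homogeneous in `y`), the fundamental
tensor `g_{ij} = ½ ∂²F²/∂y^i∂y^j` (symmetric and positive definite) with its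
inverse `g^{ij}`, the spray coefficients
`G^i = (g^{ij}/4)(∂²F²/∂y^j∂x^k y^k − ∂F²/∂x^j)` and the nonlinear connection
coefficients `G_i^j = ∂G^j/∂y^i`. -/
structure Chart (n : ℕ) : Type where
  /-- the chart domain in `TM` -/
  U : Set (Pt n)
  hUopen : IsOpen U
  hUslit : ∀ p ∈ U, p.2 ≠ 0
  /-- the fundamental function `F` -/
  F : Pt n → ℝ
  Fpos : ∀ p ∈ U, 0 < F p
  Fsmooth : ContDiffOn ℝ (⊤ : ℕ∞) F U
  Fhomog : ∀ p ∈ U, ∀ t : ℝ, 0 < t → (p.1, t • p.2) ∈ U →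
    F (p.1, t • p.2) = t * F p
  /-- the fundamental tensor `g_{ij}` -/
  g : Fin n → Fin n → Pt n → ℝ
  gdef : ∀ i j, ∀ p ∈ U,
    g i j p = (1/2) * pd (ey i) (pd (ey j) (fun q => F q ^ 2)) p
  gsmooth : ∀ i j, ContDiffOn ℝ (⊤ : ℕ∞) (g i j) U
  gsymm : ∀ i j, ∀ p ∈ U, g i j p = g j i p
  gposdef : ∀ p ∈ U, ∀ v : Fin n → ℝ, v ≠ 0 →
    0 < ∑ i, ∑ j, g i j p * v i * v j
  /-- the inverse `g^{ij}` of the fundamental tensor -/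
  ginv : Fin n → Fin n → Pt n → ℝ
  hginv : ∀ i j, ∀ p ∈ U,
    (∑ k, g i k p * ginv k j p) = if i = j then (1:ℝ) else 0
  /-- the spray coefficients `G^i` -/
  spray : Fin n → Pt n → ℝ
  spraydef : ∀ i, ∀ p ∈ U, spray i p = (1/4) * ∑ j, ginv i j p *
      ((∑ k, pd (ey j) (pd (ex k) (fun q => F q ^ 2)) p * p.2 k)
        - pd (ex j) (fun q => F q ^ 2) p)
  /-- the nonlinear connection coefficients `G_i^j` -/
  N : Fin n → Fin n → Pt n → ℝ
  Ndef : ∀ i j, ∀ p ∈ U, N i j p = pd (ey i) (spray j) p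
  Nsmooth : ∀ i j, ContDiffOn ℝ (⊤ : ℕ∞) (N i j) U

variable (fc : Chart n)

/-- the vertical frame field `∂/∂y^i`. -/
def dyv (i : Fin n) : VF n := fun _ => ey i

/-- the horizontal frame field `δ/δx^i = ∂/∂x^i − G_i^j ∂/∂y^j`. -/
def ddx (i : Fin n) : VF n := fun p => (Pi.single i 1, fun j => -(fc.N i j p))

/-- the vertical Liouville vector field `L = y^i ∂/∂y^i`. -/
def LV : VF n := fun p => ((0 : Fin n → ℝ), p.2)

/-- the horizontal Liouville vector field `ξ = y^i δ/δx^i`. -/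
def XI : VF n := fun p => (p.2, fun j => -(∑ i, p.2 i * fc.N i j p))

/-- the dual coframe `δy^i = dy^i + G_j^i dx^j`, applied to a tangent vector. -/
def dely (i : Fin n) (p : Pt n) (v : Pt n) : ℝ := v.2 i + ∑ j, fc.N j i p * v.1 j

/-- the Sasaki lifted metric `G = g_{ij} dx^i ⊗ dx^j + g_{ij} δy^i ⊗ δy^j`. -/
def Gs (p : Pt n) (v w : Pt n) : ℝ :=
  ∑ i, ∑ j, fc.g i j p * (v.1 i * w.1 j + dely fc i p v * dely fc j p w)

/-- the natural almost complex structure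
`J = δ/δx^i ⊗ δy^i − ∂/∂y^i ⊗ dx^i`, as a pointwise endomorphism. -/
def Jm (p : Pt n) (v : Pt n) : Pt n :=
  (fun i => dely fc i p v,
   fun k => -(∑ i, dely fc i p v * fc.N i k p) - v.1 k)

/-- `J` applied to a vector field. -/
def Jvf (X : VF n) : VF n := fun p => Jm fc p (X p)

/-- the curvature coefficients `R^k_{ij} = δG_i^k/δx^j − δG_j^k/δx^i` of the
nonlinear connection. -/
def Rc (i j k : Fin n) (p : Pt n) : ℝ :=
  Dv (ddx fc j) (fc.N i k) p - Dv (ddx fc i) (fc.N j k) p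

/-- the Cartan tensor `g_{ijk} = ½ ∂g_{ij}/∂y^k`. -/
def Cartan (i j k : Fin n) (p : Pt n) : ℝ := (1/2) * pd (ey k) (fc.g i j) p

/-- the vertical adapted frame field `∂̄/∂̄y^a = E_a^i ∂/∂y^i`. -/
def vb (E : Fin (n-1) → Fin n → Pt n → ℝ) (a : Fin (n-1)) : VF n :=
  fun p => ((0 : Fin n → ℝ), fun i => E a i p)

/-- the horizontal adapted frame field `δ̄/δ̄x^a = J(∂̄/∂̄y^a)`. -/
def hb (E : Fin (n-1) → Fin n → Pt n → ℝ) (a : Fin (n-1)) : VF n :=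
  fun p => Jm fc p (vb E a p)

/-- `E` is the coefficient matrix of an adapted local frame
`∂̄/∂̄y^a = E_a^i ∂/∂y^i`, `a = 1, …, n−1`, of the distribution `V'TM` (the
`G`-orthogonal complement of the vertical Liouville field `L` inside the
vertical distribution `VTM`): the coefficients are smooth, pointwise linearly
independent, and each `∂̄/∂̄y^a` is `G`-orthogonal to `L`. -/
def IsAdaptedFrame (E : Fin (n-1) → Fin n → Pt n → ℝ) : Prop :=
  (∀ a i, ContDiffOn ℝ (⊤ : ℕ∞) (E a i) fc.U) ∧
  (∀ p ∈ fc.U, LinearIndependent ℝ (fun a : Fin (n-1) => (fun i => E a i p))) ∧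
  (∀ a, ∀ p ∈ fc.U, Gs fc p (vb E a p) (LV p) = 0)

/-- `g_{ab} = g_{ij} E_a^i E_b^j`, the components of the Sasaki metric in the
adapted frame. -/
def gb (E : Fin (n-1) → Fin n → Pt n → ℝ) (p : Pt n) (a b : Fin (n-1)) : ℝ :=
  ∑ i, ∑ j, fc.g i j p * E a i p * E b j p

/-- the matrix `(g_{ab})`. -/
def gbMat (E : Fin (n-1) → Fin n → Pt n → ℝ) (p : Pt n) :
    Matrix (Fin (n-1)) (Fin (n-1)) ℝ :=
  Matrix.of fun a b => gb fc E p a b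

/-- `(g^{ab})`, the inverse of the matrix `(g_{ab})`. -/
def gbInv (E : Fin (n-1) → Fin n → Pt n → ℝ) (p : Pt n) (a b : Fin (n-1)) : ℝ :=
  (gbMat fc E p)⁻¹ a b

/-- `g_{abc} = ½ E_a^i E_b^j E_c^k g_{ijk}`, the Cartan tensor in the adapted
frame. -/
def CartanBar (E : Fin (n-1) → Fin n → Pt n → ℝ) (a b c : Fin (n-1))
    (p : Pt n) : ℝ :=
  (1/2) * ∑ i, ∑ j, ∑ k, E a i p * E b j p * E c k p * Cartan fc i j k p

/-- `R_{cab} = E_c^i E_a^j E_b^k R^h_{jk} g_{hi}`, the lowered curvature of the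
nonlinear connection in the adapted frame. -/
def Rlow (E : Fin (n-1) → Fin n → Pt n → ℝ) (c a b : Fin (n-1)) (p : Pt n) : ℝ :=
  ∑ i, ∑ j, ∑ k, ∑ h, E c i p * E a j p * E b k p * Rc fc j k h p * fc.g h i p

/-- `nab` is the Levi-Civita connection of the Sasaki metric `G` on the chart
domain, characterized by the Koszul formula
`2G(∇_X Y, Z) = X G(Y,Z) + Y G(X,Z) − Z G(X,Y)
  − G([X,Z],Y) − G([Y,Z],X) + G([X,Y],Z)`. -/
def IsLeviCivita (nab : VF n → VF n → VF n) : Prop :=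
  ∀ X Y Z : VF n,
    ContDiffOn ℝ (⊤ : ℕ∞) X fc.U → ContDiffOn ℝ (⊤ : ℕ∞) Y fc.U →
    ContDiffOn ℝ (⊤ : ℕ∞) Z fc.U → ∀ p ∈ fc.U,
    2 * Gs fc p (nab X Y p) (Z p) =
      Dv X (fun q => Gs fc q (Y q) (Z q)) p
      + Dv Y (fun q => Gs fc q (X q) (Z q)) p
      - Dv Z (fun q => Gs fc q (X q) (Y q)) p
      - Gs fc p (lie X Z p) (Y p)
      - Gs fc p (lie Y Z p) (X p)
      + Gs fc p (lie X Y p) (Z p)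

/-- the `G`-orthogonal projection of a vector field onto the line spanned by
the vertical Liouville field `L` (the normal direction to the indicatrix). -/
def projL (X : VF n) : VF n :=
  fun p => (Gs fc p (X p) (LV p) / Gs fc p (LV p) (LV p)) • LV p

/-- the curvature tensor `R(X,Y)Z = ∇_X ∇_Y Z − ∇_Y ∇_X Z − ∇_{[X,Y]} Z` of a
connection. -/
def curv (nab : VF n → VF n → VF n) (X Y Z : VF n) : VF n :=
  fun p => nab X (nab Y Z) p - nab Y (nab X Z) p - nab (lie X Y) Z p

/-- membership in `V'TM`: vertical and `G`-orthogonal to `L`. -/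
def InV' (p v : Pt n) : Prop := v.1 = 0 ∧ Gs fc p v (LV p) = 0

/-- membership in `V^⊥TM`: `G`-orthogonal to `L`. -/
def InVperp (p v : Pt n) : Prop := Gs fc p v (LV p) = 0

/-- membership in `HTM ⊕ ⟨L⟩`, the `G`-orthogonal complement of `V'TM`. -/
def InHL (p v : Pt n) : Prop := ∃ c : ℝ, ∀ i, dely fc i p v = c * p.2 i

/-- membership in the line spanned by the vertical Liouville field `L`. -/
def InL (p v : Pt n) : Prop := ∃ c : ℝ, v = c • LV p

/-- membership in the plane spanned by `L` and `ξ`. -/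
def InLXi (p v : Pt n) : Prop := ∃ c d : ℝ, v = c • LV p + d • XI fc p

/-- membership in the `G`-orthogonal complement of `⟨L, ξ⟩`. -/
def InLXiPerp (p v : Pt n) : Prop :=
  Gs fc p v (LV p) = 0 ∧ Gs fc p v (XI fc p) = 0

/-- the contact `1`-form `η = y^i g_{ij} dx^j` of the indicatrix bundle,
applied to a tangent vector. -/
def etaC (p : Pt n) (v : Pt n) : ℝ := ∑ i, ∑ j, p.2 i * fc.g i j p * v.1 j

/-- the `(1,1)`-tensor `φ` of the contact structure of the indicatrix bundle:
`φ = J` on the contact distribution `D` and `φ(ξ) = 0`; on tangent vectors of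
`IM` it is given by `φ(v) = J v + η(v) L`. -/
def phiC (p : Pt n) (v : Pt n) : Pt n := Jm fc p v + etaC fc p v • LV p

/-- `φ` applied to a vector field. -/
def phiVF (X : VF n) : VF n := fun p => phiC fc p (X p)

/-- `η` applied to a vector field, as a scalar function. -/
def etaVF (X : VF n) : Pt n → ℝ := fun p => etaC fc p (X p)

/-- the exterior derivative `dη(X,Y) = X(η(Y)) − Y(η(X)) − η([X,Y])`. -/
def dEta (X Y : VF n) (p : Pt n) : ℝ :=
  Dv X (etaVF fc Y) p - Dv Y (etaVF fc X) p - etaC fc p (lie X Y p)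

/-- the normality tensor `N^{(1)} = [φ,φ] + 2 dη ⊗ ξ` of the contact structure
of the indicatrix bundle, evaluated on vector fields, where
`[φ,φ](X,Y) = φ²[X,Y] + [φX,φY] − φ[φX,Y] − φ[X,φY]` is the Nijenhuis torsion
of `φ`. -/
def Ntensor (X Y : VF n) : VF n := fun p =>
  phiC fc p (phiC fc p (lie X Y p)) + lie (phiVF fc X) (phiVF fc Y) p
    - phiC fc p (lie (phiVF fc X) Y p) - phiC fc p (lie X (phiVF fc Y) p)
    + (2 * dEta fc X Y p) • XI fc p

/-- a vector field of `TM` is tangent to the indicatrix bundle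
`IM = {F = 1}` (equivalently, `G`-orthogonal to the normal field `L` along
`IM`). -/
def TangentIM (X : VF n) : Prop :=
  ∀ p ∈ fc.U, fc.F p = 1 → Gs fc p (X p) (LV p) = 0

/-- The indicatrix bundle `IM`, with its natural contact metric structure
`(φ, η, ξ, Ḡ)`, is a Sasakian manifold: the contact structure is normal, i.e.
the tensor `N^{(1)} = [φ,φ] + 2 dη ⊗ ξ` vanishes on vector fields tangent to
`IM`. -/
def IsSasakianIM : Prop :=
  ∀ X Y : VF n, ContDiffOn ℝ (⊤ : ℕ∞) X fc.U → ContDiffOn ℝ (⊤ : ℕ∞) Y fc.U →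
    TangentIM fc X → TangentIM fc Y →
    ∀ p ∈ fc.U, fc.F p = 1 → Ntensor fc X Y p = 0

/-- the Nijenhuis tensor of the natural almost complex structure `J`:
`N_J(X,Y) = [JX,JY] − J[JX,Y] − J[X,JY] + J²[X,Y]`, with `J² = −Id`. -/
def NijJ (X Y : VF n) : VF n := fun p =>
  lie (Jvf fc X) (Jvf fc Y) p - Jm fc p (lie (Jvf fc X) Y p)
    - Jm fc p (lie X (Jvf fc Y) p) - lie X Y p

/-- the almost complex structure `J̄` on `TM ≅ IM × ℝ` induced by the contact
structure `(φ, η, ξ)` of the indicatrix bundle via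
`J̄(X + f L) = φ(X) − f ξ + η(X) L`, where `X` is tangent to `IM`;
a tangent vector `v` is decomposed as `v = vᵀ + f L` with
`f = G(v,L)/G(L,L)` and `vᵀ` tangent to the indicatrix. -/
def Jbar (p : Pt n) (v : Pt n) : Pt n :=
  phiC fc p (v - (Gs fc p v (LV p) / Gs fc p (LV p) (LV p)) • LV p)
    - (Gs fc p v (LV p) / Gs fc p (LV p) (LV p)) • XI fc p
    + etaC fc p (v - (Gs fc p v (LV p) / Gs fc p (LV p) (LV p)) • LV p) • LV p


section Homogeneity

/-- The fibre dilation `(x, y) ↦ (x, t y)`. -/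
def dilation (t : ℝ) (ht : t ≠ 0) : Pt n ≃L[ℝ] Pt n :=
  (ContinuousLinearEquiv.refl ℝ (Fin n → ℝ)).prodCongr
    (ContinuousLinearEquiv.smulLeft (Units.mk0 t ht))

lemma dilation_apply (t : ℝ) (ht : t ≠ 0) (p : Pt n) : dilation t ht p = (p.1, t • p.2) := rfl

/-- Positive homogeneity of degree `k` in the fibre variable, relative to a set `U`. -/
def HomogOn (U : Set (Pt n)) (k : ℕ) (f : Pt n → ℝ) : Prop :=
  ∀ p ∈ U, ∀ t : ℝ, 0 < t → (p.1, t • p.2) ∈ U → f (p.1, t • p.2) = t ^ k * f p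

variable {U : Set (Pt n)}

lemma HomogOn.mul {k l : ℕ} {f g : Pt n → ℝ} (hf : HomogOn U k f) (hg : HomogOn U l g) :
    HomogOn U (k + l) (fun q => f q * g q) := by
  intro p hp t ht hq
  simp only [hf p hp t ht hq, hg p hp t ht hq]
  ring

lemma HomogOn.sum {k : ℕ} {ι : Type*} {s : Finset ι} {f : ι → Pt n → ℝ}
    (hf : ∀ i ∈ s, HomogOn U k (f i)) : HomogOn U k (fun q => ∑ i ∈ s, f i q) := by
  intro p hp t ht hq
  simp only [Finset.mul_sum]
  exact Finset.sum_congr rfl fun i hi => hf i hi p hp t ht hq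

lemma HomogOn.sub {k : ℕ} {f g : Pt n → ℝ} (hf : HomogOn U k f) (hg : HomogOn U k g) :
    HomogOn U k (fun q => f q - g q) := by
  intro p hp t ht hq
  simp only [hf p hp t ht hq, hg p hp t ht hq]
  ring

lemma HomogOn.const (c : ℝ) : HomogOn U 0 (fun _ : Pt n => c) := by
  intro p _ t _ _
  simp

lemma HomogOn.coord (i : Fin n) : HomogOn U 1 (fun q : Pt n => q.2 i) := by
  intro p _ t _ _
  simp

lemma HomogOn.congr {k : ℕ} {f g : Pt n → ℝ} (hf : HomogOn U k f) (h : ∀ p ∈ U, g p = f p) :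
    HomogOn U k g := by
  intro p hp t ht hq
  rw [h _ hq, h p hp, hf p hp t ht hq]

lemma HomogOn.fderiv_dilation (hU : IsOpen U) {k : ℕ} {f : Pt n → ℝ} (hf : HomogOn U k f)
    {p : Pt n} (hp : p ∈ U) {t : ℝ} (ht : 0 < t) (hq : (p.1, t • p.2) ∈ U) (v : Pt n) :
    fderiv ℝ f (p.1, t • p.2) (v.1, t • v.2) = t ^ k * fderiv ℝ f p v := by
  have hev : f ∘ dilation t ht.ne' =ᶠ[nhds p] fun q => t ^ k * f q := by
    filter_upwards [hU.mem_nhds hp,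
      (dilation t ht.ne').continuous.continuousAt.preimage_mem_nhds (hU.mem_nhds hq)] with q h1 h2
    exact hf q h1 t ht h2
  have h := hev.fderiv_eq (𝕜 := ℝ)
  rw [ContinuousLinearEquiv.comp_right_fderiv] at h
  have h2 := congrArg (fun l => l v) h
  have h3 : fderiv ℝ (fun q => t ^ k * f q) p = t ^ k • fderiv ℝ f p := by
    change fderiv ℝ (t ^ k • f) p = _
    rw [fderiv_const_smul_field]
    rfl
  rw [h3] at h2
  simpa [dilation_apply] using h2

lemma HomogOn.pd_ex (hU : IsOpen U) {k : ℕ} {f : Pt n → ℝ} (hf : HomogOn U k f) (i : Fin n) :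
    HomogOn U k (pd (ex i) f) := by
  intro p hp t ht hq
  simpa [pd, ex] using hf.fderiv_dilation hU hp ht hq (ex i)

lemma HomogOn.pd_ey (hU : IsOpen U) {k : ℕ} {f : Pt n → ℝ} (hf : HomogOn U (k + 1) f)
    (i : Fin n) : HomogOn U k (pd (ey i) f) := by
  intro p hp t ht hq
  have h := hf.fderiv_dilation hU hp ht hq (ey i)
  have h2 : ((ey i).1, t • (ey i).2) = t • (ey i : Pt n) := by ext <;> simp [ey]
  rw [h2, map_smul, smul_eq_mul, pow_succ] at h
  exact mul_left_cancel₀ ht.ne' (by simp only [pd]; linarith)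

/-- Euler's theorem on homogeneous functions. -/
lemma HomogOn.euler (hU : IsOpen U) {k : ℕ} {f : Pt n → ℝ} (hf : HomogOn U k f)
    {p : Pt n} (hp : p ∈ U) (hd : DifferentiableAt ℝ f p) :
    fderiv ℝ f p (0, p.2) = k * f p := by
  have hc : HasDerivAt (fun t : ℝ => ((p.1, t • p.2) : Pt n)) (0, p.2) 1 := by
    simpa using (hasDerivAt_const (1 : ℝ) p.1).prodMk
      ((hasDerivAt_id (1 : ℝ)).smul_const p.2)
  have h1 : (fun t : ℝ => ((p.1, t • p.2) : Pt n)) 1 = p := by simp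
  have hd' : HasFDerivAt f (fderiv ℝ f p) ((fun t : ℝ => ((p.1, t • p.2) : Pt n)) 1) := by
    rw [h1]; exact hd.hasFDerivAt
  have hl := hd'.comp_hasDerivAt (1 : ℝ) hc
  have hr : HasDerivAt (fun t : ℝ => t ^ k * f p) (k * f p) 1 := by
    simpa using (hasDerivAt_pow k (1 : ℝ)).mul_const (f p)
  have hev : (f ∘ fun t : ℝ => ((p.1, t • p.2) : Pt n)) =ᶠ[nhds 1] fun t => t ^ k * f p := by
    have hm : U ∈ nhds ((fun t : ℝ => ((p.1, t • p.2) : Pt n)) 1) := by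
      rw [h1]; exact hU.mem_nhds hp
    filter_upwards [hc.continuousAt.preimage_mem_nhds hm, lt_mem_nhds one_pos] with t h2 h3
    exact hf p hp t h3 h2
  exact hl.unique (hr.congr_of_eventuallyEq hev)

end Homogeneity

section Linear

lemma map_vertical {W : Type*} [AddCommGroup W] [Module ℝ W] [TopologicalSpace W]
    (l : Pt n →L[ℝ] W) (w : Fin n → ℝ) : l (0, w) = ∑ i, w i • l (ey i) := by
  have : ((0, w) : Pt n) = ∑ i, w i • ey i := by
    ext j <;> simp [ey, Prod.fst_sum, Prod.snd_sum, Finset.sum_apply, Pi.single_apply]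
  rw [this, map_sum]
  simp

lemma map_base {W : Type*} [AddCommGroup W] [Module ℝ W] [TopologicalSpace W]
    (l : Pt n →L[ℝ] W) (w : Fin n → ℝ) : l (w, 0) = ∑ i, w i • l (ex i) := by
  have : ((w, 0) : Pt n) = ∑ i, w i • ex i := by
    ext j <;> simp [ex, Prod.fst_sum, Prod.snd_sum, Finset.sum_apply, Pi.single_apply]
  rw [this, map_sum]
  simp

end Linear

/-- The fundamental tensor as a bilinear form on `ℝⁿ`. -/
def gForm (q : Pt n) : (Fin n → ℝ) →L[ℝ] (Fin n → ℝ) →L[ℝ] ℝ :=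
  ∑ i, ∑ j, fc.g i j q • (ContinuousLinearMap.proj (R := ℝ) (φ := fun _ : Fin n => ℝ) i).smulRight
    (ContinuousLinearMap.proj (R := ℝ) (φ := fun _ : Fin n => ℝ) j)

lemma gForm_apply (q : Pt n) (u w : Fin n → ℝ) :
    gForm fc q u w = ∑ i, ∑ j, fc.g i j q * (u i * w j) := by
  simp [gForm]

/-- The nonlinear connection as an endomorphism of `ℝⁿ`. -/
def nMap (q : Pt n) : (Fin n → ℝ) →L[ℝ] (Fin n → ℝ) :=
  ∑ i, ∑ j, fc.N j i q • (ContinuousLinearMap.proj (R := ℝ) (φ := fun _ : Fin n => ℝ) j).smulRight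
    (Pi.single i 1 : Fin n → ℝ)

lemma nMap_apply (q : Pt n) (u : Fin n → ℝ) (i : Fin n) :
    nMap fc q u i = ∑ j, fc.N j i q * u j := by
  simp [nMap, Finset.sum_apply, Pi.single_apply]

lemma contDiffOn_gForm : ContDiffOn ℝ (⊤ : ℕ∞) (gForm fc) fc.U := by
  refine contDiffOn_clm_apply.2 fun u => contDiffOn_clm_apply.2 fun w => ?_
  simp only [gForm_apply]
  exact ContDiffOn.sum fun i _ => ContDiffOn.sum fun j _ => (fc.gsmooth i j).mul contDiffOn_const

lemma contDiffOn_nMap : ContDiffOn ℝ (⊤ : ℕ∞) (nMap fc) fc.U := by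
  unfold nMap
  exact ContDiffOn.sum fun i _ => ContDiffOn.sum fun j _ => (fc.Nsmooth j i).smul contDiffOn_const

lemma gForm_symm {p : Pt n} (hp : p ∈ fc.U) (u w : Fin n → ℝ) :
    gForm fc p u w = gForm fc p w u := by
  rw [gForm_apply, gForm_apply, Finset.sum_comm]
  refine Finset.sum_congr rfl fun i _ => Finset.sum_congr rfl fun j _ => ?_
  rw [fc.gsymm j i p hp]
  ring

lemma gForm_pos {p : Pt n} (hp : p ∈ fc.U) {u : Fin n → ℝ} (hu : u ≠ 0) :
    0 < gForm fc p u u := by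
  simpa [gForm_apply, mul_assoc] using fc.gposdef p hp u hu

/-- The vertical part of a tangent vector. -/
def vert (p v : Pt n) : Fin n → ℝ := v.2 + nMap fc p v.1

lemma vert_apply (p v : Pt n) (i : Fin n) : vert fc p v i = dely fc i p v := by
  simp [vert, dely, nMap_apply]

lemma Gs_eq (p v w : Pt n) :
    Gs fc p v w = gForm fc p v.1 w.1 + gForm fc p (vert fc p v) (vert fc p w) := by
  simp only [Gs, gForm_apply, vert_apply, mul_add, Finset.sum_add_distrib]

section FinslerIdentities

/-- The square `F²` of the fundamental function. -/
def sqF (q : Pt n) : ℝ := fc.F q ^ 2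

variable {fc} {p : Pt n}

lemma contDiffAt_sqF (hp : p ∈ fc.U) : ContDiffAt ℝ (⊤ : ℕ∞) (sqF fc) p :=
  (fc.Fsmooth.pow 2).contDiffAt (fc.hUopen.mem_nhds hp)

lemma contDiffAt_fderiv_sqF (hp : p ∈ fc.U) : ContDiffAt ℝ (⊤ : ℕ∞) (fderiv ℝ (sqF fc)) p :=
  (contDiffAt_sqF hp).fderiv_right (by simp)

lemma differentiableAt_fderiv_sqF (hp : p ∈ fc.U) :
    DifferentiableAt ℝ (fderiv ℝ (sqF fc)) p :=
  (contDiffAt_fderiv_sqF hp).differentiableAt (by simp)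

lemma differentiableAt_gForm (hp : p ∈ fc.U) : DifferentiableAt ℝ (gForm fc) p :=
  ((contDiffOn_gForm fc).contDiffAt (fc.hUopen.mem_nhds hp)).differentiableAt (by simp)

lemma differentiableAt_nMap (hp : p ∈ fc.U) : DifferentiableAt ℝ (nMap fc) p :=
  ((contDiffOn_nMap fc).contDiffAt (fc.hUopen.mem_nhds hp)).differentiableAt (by simp)

lemma fderiv_pd_sqF (hp : p ∈ fc.U) (u v : Pt n) :
    fderiv ℝ (pd u (sqF fc)) p v = fderiv ℝ (fderiv ℝ (sqF fc)) p v u := by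
  have := (differentiableAt_fderiv_sqF hp).hasFDerivAt.clm_apply (hasFDerivAt_const u p)
  have h2 : fderiv ℝ (pd u (sqF fc)) p = _ := this.fderiv
  rw [h2]
  simp

lemma differentiableAt_pd_sqF (hp : p ∈ fc.U) (u : Pt n) :
    DifferentiableAt ℝ (pd u (sqF fc)) p :=
  (differentiableAt_fderiv_sqF hp).clm_apply (differentiableAt_const u)

lemma fderiv_fderiv_sqF_symm (hp : p ∈ fc.U) (u v : Pt n) :
    fderiv ℝ (fderiv ℝ (sqF fc)) p u v = fderiv ℝ (fderiv ℝ (sqF fc)) p v u :=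
  ((contDiffAt_sqF hp).isSymmSndFDerivAt (by
    simp only [minSmoothness_of_isRCLikeNormedField]
    exact WithTop.coe_le_coe.2 (le_top : (2 : ℕ∞) ≤ ⊤))) u v

lemma homogOn_sqF : HomogOn fc.U 2 (sqF fc) := by
  intro p hp t ht hq
  simp only [sqF, fc.Fhomog p hp t ht hq]
  ring

lemma homogOn_g (i j : Fin n) : HomogOn fc.U 0 (fc.g i j) := by
  have h : HomogOn fc.U 0 (fun q => (1 / 2 : ℝ) * pd (ey i) (pd (ey j) (sqF fc)) q) :=
    (HomogOn.const _).mul ((homogOn_sqF.pd_ey fc.hUopen j).pd_ey fc.hUopen i)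
  exact h.congr fun p hp => fc.gdef i j p hp

lemma fderiv_fderiv_sqF_vertical (hp : p ∈ fc.U) (u w : Fin n → ℝ) :
    fderiv ℝ (fderiv ℝ (sqF fc)) p (0, u) (0, w) = 2 * gForm fc p u w := by
  rw [gForm_apply, map_vertical (fderiv ℝ (fderiv ℝ (sqF fc)) p) u]
  simp only [_root_.sum_apply, _root_.smul_apply, smul_eq_mul]
  rw [Finset.mul_sum]
  refine Finset.sum_congr rfl fun i _ => ?_
  rw [map_vertical _ w, Finset.mul_sum, Finset.mul_sum]
  refine Finset.sum_congr rfl fun j _ => ?_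
  have h : fc.g i j p = (1 / 2) * pd (ey i) (pd (ey j) (sqF fc)) p := fc.gdef i j p hp
  rw [h, pd, fderiv_pd_sqF hp, smul_eq_mul]
  ring

/-- `∂F²/∂y^j = 2 g_{jl} y^l`. -/
lemma fderiv_sqF_vertical (hp : p ∈ fc.U) (w : Fin n → ℝ) :
    fderiv ℝ (sqF fc) p (0, w) = 2 * gForm fc p p.2 w := by
  rw [← fderiv_fderiv_sqF_vertical hp, map_vertical _ w, map_vertical _ w]
  refine Finset.sum_congr rfl fun j _ => ?_
  have h := (homogOn_sqF.pd_ey fc.hUopen j).euler fc.hUopen hp (differentiableAt_pd_sqF hp _)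
  rw [fderiv_pd_sqF hp] at h
  rw [h]
  simp [pd]

lemma sqF_eq (hp : p ∈ fc.U) : sqF fc p = gForm fc p p.2 p.2 := by
  have h := homogOn_sqF.euler fc.hUopen hp ((contDiffAt_sqF hp).differentiableAt (by simp))
  rw [fderiv_sqF_vertical hp] at h
  push_cast at h
  linarith

lemma fderiv_gForm_apply (hp : p ∈ fc.U) (v : Pt n) (u w : Fin n → ℝ) :
    fderiv ℝ (fun q => gForm fc q u w) p v = fderiv ℝ (gForm fc) p v u w := by
  have h := ((differentiableAt_gForm hp).hasFDerivAt.clm_apply (hasFDerivAt_const u p)).clm_apply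
    (hasFDerivAt_const w p)
  rw [h.fderiv]
  simp

lemma fderiv_gForm_symm (hp : p ∈ fc.U) (v : Pt n) (u w : Fin n → ℝ) :
    fderiv ℝ (gForm fc) p v u w = fderiv ℝ (gForm fc) p v w u := by
  rw [← fderiv_gForm_apply hp, ← fderiv_gForm_apply hp]
  have : (fun q => gForm fc q u w) =ᶠ[nhds p] fun q => gForm fc q w u := by
    filter_upwards [fc.hUopen.mem_nhds hp] with q hq using gForm_symm fc hq u w
  rw [this.fderiv_eq]

lemma fderiv_gForm_liouville (hp : p ∈ fc.U) : fderiv ℝ (gForm fc) p (0, p.2) = 0 := by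
  ext u w
  rw [← fderiv_gForm_apply hp]
  have hh : HomogOn fc.U 0 (fun q => gForm fc q u w) := by
    simp only [gForm_apply]
    exact HomogOn.sum fun i _ => HomogOn.sum fun j _ => (homogOn_g i j).mul (HomogOn.const _)
  rw [hh.euler fc.hUopen hp (((differentiableAt_gForm hp).clm_apply
    (differentiableAt_const u)).clm_apply (differentiableAt_const w))]
  simp

/-- The derivative of `∂F²/∂y^j = 2 g_{jl} y^l`. -/
lemma fderiv_fderiv_sqF_right_vertical (hp : p ∈ fc.U) (v : Pt n) (w : Fin n → ℝ) :
    fderiv ℝ (fderiv ℝ (sqF fc)) p v (0, w) =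
      2 * fderiv ℝ (gForm fc) p v p.2 w + 2 * gForm fc p v.2 w := by
  have h := (((differentiableAt_gForm hp).hasFDerivAt.clm_apply
    (hasFDerivAt_snd (𝕜 := ℝ) (p := p))).clm_apply (hasFDerivAt_const w p)).const_mul 2
  have hev : pd (0, w) (sqF fc) =ᶠ[nhds p] fun q => 2 * gForm fc q q.2 w := by
    filter_upwards [fc.hUopen.mem_nhds hp] with q hq using fderiv_sqF_vertical hq w
  rw [← fderiv_pd_sqF hp, hev.fderiv_eq, h.fderiv]
  simp
  ring

lemma fderiv_gForm_vertical (hp : p ∈ fc.U) (u w : Fin n → ℝ) :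
    fderiv ℝ (gForm fc) p (0, u) p.2 w = 0 := by
  have h1 := fderiv_fderiv_sqF_right_vertical hp (0, u) w
  have h2 := fderiv_fderiv_sqF_vertical hp u w
  simp only at h1
  linarith

/-- The spray coefficients as a vector. -/
def sprayVec (fc : Chart n) (q : Pt n) : Fin n → ℝ := fun i => fc.spray i q

lemma ginv_eq_inv (hp : p ∈ fc.U) (i j : Fin n) :
    fc.ginv i j p = (Matrix.of fun i j => fc.g i j p)⁻¹ i j := by
  have h : (Matrix.of fun i j => fc.g i j p) * (Matrix.of fun i j => fc.ginv i j p) = 1 := by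
    ext i j
    simpa [Matrix.mul_apply, Matrix.one_apply] using fc.hginv i j p hp
  rw [Matrix.inv_eq_right_inv h, Matrix.of_apply]

lemma homogOn_ginv (i j : Fin n) : HomogOn fc.U 0 (fc.ginv i j) := by
  intro p hp t ht hq
  have h : ∀ i j, fc.g i j (p.1, t • p.2) = fc.g i j p := fun i j => by
    simpa using homogOn_g i j p hp t ht hq
  simp [ginv_eq_inv hp, ginv_eq_inv hq, h]

lemma differentiableAt_det {m : ℕ} {A : Pt n → Matrix (Fin m) (Fin m) ℝ}
    (hA : ∀ i j, DifferentiableAt ℝ (fun q => A q i j) p) :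
    DifferentiableAt ℝ (fun q => (A q).det) p := by
  simp only [Matrix.det_apply']
  refine DifferentiableAt.fun_sum fun σ _ => DifferentiableAt.const_mul ?_ _
  exact (HasFDerivAt.finsetProd fun i _ => (hA (σ i) i).hasFDerivAt).differentiableAt

lemma differentiableAt_g (hp : p ∈ fc.U) (i j : Fin n) : DifferentiableAt ℝ (fc.g i j) p :=
  ((fc.gsmooth i j).contDiffAt (fc.hUopen.mem_nhds hp)).differentiableAt (by simp)

lemma differentiableAt_ginv (hp : p ∈ fc.U) (i j : Fin n) :
    DifferentiableAt ℝ (fc.ginv i j) p := by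
  have hdet : (Matrix.of fun i j => fc.g i j p).det ≠ 0 := by
    have h : (Matrix.of fun i j => fc.g i j p) * (Matrix.of fun i j => fc.ginv i j p) = 1 := by
      ext i j
      simpa [Matrix.mul_apply, Matrix.one_apply] using fc.hginv i j p hp
    exact ((Matrix.isUnit_iff_isUnit_det _).1 (IsUnit.of_mul_eq_one _ h)).ne_zero
  have hev : fc.ginv i j =ᶠ[nhds p] fun q => (Matrix.of fun i j => fc.g i j q).det⁻¹ *
      ((Matrix.of fun i j => fc.g i j q).updateRow j (Pi.single i 1)).det := by
    filter_upwards [fc.hUopen.mem_nhds hp] with q hq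
    rw [ginv_eq_inv hq, Matrix.inv_def, Ring.inverse_eq_inv', Matrix.smul_apply,
      Matrix.adjugate_apply, smul_eq_mul]
  refine DifferentiableAt.congr_of_eventuallyEq ?_ hev
  refine ((differentiableAt_det fun k l => ?_).inv hdet).mul (differentiableAt_det fun k l => ?_)
  · exact differentiableAt_g hp k l
  · by_cases hk : k = j
    · subst hk
      simp
    · simpa [Matrix.updateRow_ne hk] using differentiableAt_g hp k l

lemma spray_eq (hp : p ∈ fc.U) (i : Fin n) :
    fc.spray i p = (1 / 4) * ∑ j, fc.ginv i j p *
      ((∑ k, pd (ey j) (pd (ex k) (sqF fc)) p * p.2 k) - pd (ex j) (sqF fc) p) :=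
  fc.spraydef i p hp

lemma homogOn_spray (i : Fin n) : HomogOn fc.U 2 (fc.spray i) := by
  have h : HomogOn fc.U 2 (fun q => (1 / 4) * ∑ j, fc.ginv i j q *
      ((∑ k, pd (ey j) (pd (ex k) (sqF fc)) q * q.2 k) - pd (ex j) (sqF fc) q)) := by
    refine HomogOn.mul (k := 0) (l := 2) (HomogOn.const _) (HomogOn.sum fun j _ => ?_)
    refine HomogOn.mul (k := 0) (l := 2) (homogOn_ginv i j) (HomogOn.sub (HomogOn.sum fun k _ => ?_)
      (homogOn_sqF.pd_ex fc.hUopen j))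
    exact HomogOn.mul (k := 1) (l := 1) ((homogOn_sqF.pd_ex fc.hUopen k).pd_ey fc.hUopen j)
      (HomogOn.coord k)
  exact h.congr fun p hp => spray_eq hp i

lemma differentiableAt_spray (hp : p ∈ fc.U) (i : Fin n) :
    DifferentiableAt ℝ (fc.spray i) p := by
  have hev : fc.spray i =ᶠ[nhds p] fun q => (1 / 4) * ∑ j, fc.ginv i j q *
      ((∑ k, fderiv ℝ (fderiv ℝ (sqF fc)) q (ey j) (ex k) * q.2 k) - pd (ex j) (sqF fc) q) := by
    filter_upwards [fc.hUopen.mem_nhds hp] with q hq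
    rw [spray_eq hq]
    simp only [pd, ← fderiv_pd_sqF hq]
  refine DifferentiableAt.congr_of_eventuallyEq ?_ hev
  have h3 : DifferentiableAt ℝ (fderiv ℝ (fderiv ℝ (sqF fc))) p :=
    ((contDiffAt_fderiv_sqF hp).fderiv_right (m := 1) (by
      norm_cast)).differentiableAt (by simp)
  refine (DifferentiableAt.fun_sum fun j _ => (differentiableAt_ginv hp i j).mul
    ((DifferentiableAt.fun_sum fun k _ => ?_).sub (differentiableAt_pd_sqF hp _))).const_mul _
  exact ((h3.clm_apply (differentiableAt_const _)).clm_apply (differentiableAt_const _)).mul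
    (by fun_prop)

lemma hasFDerivAt_sprayVec (hp : p ∈ fc.U) :
    HasFDerivAt (sprayVec fc) (fderiv ℝ (sprayVec fc) p) p :=
  (differentiableAt_pi.2 fun i => differentiableAt_spray hp i).hasFDerivAt

lemma fderiv_sprayVec_apply (hp : p ∈ fc.U) (v : Pt n) (i : Fin n) :
    fderiv ℝ (sprayVec fc) p v i = fderiv ℝ (fc.spray i) p v := by
  have h := hasFDerivAt_pi'.1 (hasFDerivAt_sprayVec hp) i
  have h2 : fderiv ℝ (fc.spray i) p = _ := h.fderiv
  rw [h2]
  rfl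

/-- `G_i^j = ∂G^j/∂y^i`. -/
lemma fderiv_sprayVec_vertical (hp : p ∈ fc.U) (w : Fin n → ℝ) :
    fderiv ℝ (sprayVec fc) p (0, w) = nMap fc p w := by
  ext i
  rw [fderiv_sprayVec_apply hp, map_vertical, nMap_apply]
  refine Finset.sum_congr rfl fun j _ => ?_
  rw [fc.Ndef j i p hp, pd, smul_eq_mul, mul_comm]

/-- `y^i G_i^j = 2 G^j`. -/
lemma nMap_liouville (hp : p ∈ fc.U) : nMap fc p p.2 = (2 : ℝ) • sprayVec fc p := by
  rw [← fderiv_sprayVec_vertical hp]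
  ext i
  rw [fderiv_sprayVec_apply hp,
    (homogOn_spray i).euler fc.hUopen hp (differentiableAt_spray hp i)]
  simp [sprayVec]

lemma gForm_sprayVec (hp : p ∈ fc.U) (w : Fin n → ℝ) :
    gForm fc p (sprayVec fc p) w = (1 / 4) *
      (fderiv ℝ (fderiv ℝ (sqF fc)) p (0, w) (p.2, 0) - fderiv ℝ (sqF fc) p (w, 0)) := by
  rw [gForm_symm fc hp, gForm_apply, map_base _ w, map_vertical _ w]
  simp only [_root_.sum_apply, _root_.smul_apply, smul_eq_mul,
    ← Finset.sum_sub_distrib, Finset.mul_sum]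
  refine Finset.sum_congr rfl fun i _ => ?_
  have hA : ∀ j, (∑ k, pd (ey j) (pd (ex k) (sqF fc)) p * p.2 k) - pd (ex j) (sqF fc) p
      = fderiv ℝ (fderiv ℝ (sqF fc)) p (ey j) (p.2, 0) - fderiv ℝ (sqF fc) p (ex j) := by
    intro j
    rw [map_base _ p.2]
    simp only [pd, smul_eq_mul, ← fderiv_pd_sqF hp, mul_comm]
  have hS : ∑ j, fc.g i j p * fc.spray j p = (1 / 4) *
      (fderiv ℝ (fderiv ℝ (sqF fc)) p (ey i) (p.2, 0) - fderiv ℝ (sqF fc) p (ex i)) := by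
    rw [← hA]
    simp only [spray_eq hp]
    set A : Fin n → ℝ := fun j =>
      (∑ k, pd (ey j) (pd (ex k) (sqF fc)) p * p.2 k) - pd (ex j) (sqF fc) p with hAdef
    calc ∑ j, fc.g i j p * ((1 / 4) * ∑ l, fc.ginv j l p * A l)
        = (1 / 4) * ∑ l, (∑ j, fc.g i j p * fc.ginv j l p) * A l := by
          simp only [Finset.mul_sum, Finset.sum_mul]
          rw [Finset.sum_comm]
          refine Finset.sum_congr rfl fun l _ => Finset.sum_congr rfl fun j _ => ?_
          ring
      _ = (1 / 4) * A i := by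
          simp [fc.hginv _ _ p hp]
  calc ∑ j, fc.g i j p * (w i * sprayVec fc p j)
      = w i * ∑ j, fc.g i j p * fc.spray j p := by
        rw [Finset.mul_sum]
        refine Finset.sum_congr rfl fun j _ => ?_
        simp only [sprayVec]
        ring
    _ = _ := by rw [hS]; ring

/-- Euler's identity for the base derivatives of `F²`. -/
lemma fderiv_fderiv_sqF_liouville_base (hp : p ∈ fc.U) (w : Fin n → ℝ) :
    fderiv ℝ (fderiv ℝ (sqF fc)) p (0, p.2) (w, 0) = 2 * fderiv ℝ (sqF fc) p (w, 0) := by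
  rw [map_base _ w, map_base _ w, Finset.mul_sum]
  refine Finset.sum_congr rfl fun j _ => ?_
  have h := (homogOn_sqF.pd_ex fc.hUopen j).euler fc.hUopen hp (differentiableAt_pd_sqF hp _)
  rw [fderiv_pd_sqF hp] at h
  rw [h]
  simp [pd]
  ring

lemma gForm_sprayVec_liouville (hp : p ∈ fc.U) :
    gForm fc p (sprayVec fc p) p.2 = (1 / 4) * fderiv ℝ (sqF fc) p (p.2, 0) := by
  rw [gForm_sprayVec hp, fderiv_fderiv_sqF_liouville_base hp]
  ring

/-- `∂F²/∂x^k = 2 G_k^j g_{jl} y^l`. -/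
lemma fderiv_sqF_base (hp : p ∈ fc.U) (w : Fin n → ℝ) :
    fderiv ℝ (sqF fc) p (w, 0) = 2 * gForm fc p (nMap fc p w) p.2 := by
  have hl := ((differentiableAt_gForm hp).hasFDerivAt.clm_apply
    (hasFDerivAt_sprayVec hp)).clm_apply (hasFDerivAt_snd (𝕜 := ℝ) (p := p))
  have hb : HasFDerivAt (fun q : Pt n => ((q.2, 0) : Pt n))
      ((ContinuousLinearMap.snd ℝ (Fin n → ℝ) (Fin n → ℝ)).prod 0) p :=
    (hasFDerivAt_snd (𝕜 := ℝ) (p := p)).prodMk (hasFDerivAt_const 0 p)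
  have hr := ((differentiableAt_fderiv_sqF hp).hasFDerivAt.clm_apply hb).const_mul (1 / 4)
  have hev : (fun q => gForm fc q (sprayVec fc q) q.2) =ᶠ[nhds p]
      fun q => (1 / 4) * fderiv ℝ (sqF fc) q (q.2, 0) := by
    filter_upwards [fc.hUopen.mem_nhds hp] with q hq using gForm_sprayVec_liouville hq
  have h := congrArg (fun l => l (0, w)) (hl.unique (hr.congr_of_eventuallyEq hev))
  simp [fderiv_sprayVec_vertical hp, gForm_sprayVec hp] at h
  have h2 := fderiv_gForm_vertical hp w (sprayVec fc p)
  rw [fderiv_gForm_symm hp] at h2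
  linarith

/-- `F` is horizontally constant: `δF²/δx^k = 0`. -/
lemma fderiv_sqF_horizontal (hp : p ∈ fc.U) (w : Fin n → ℝ) :
    fderiv ℝ (sqF fc) p (w, -nMap fc p w) = 0 := by
  have h : ((w, -nMap fc p w) : Pt n) = (w, 0) + (0, -nMap fc p w) := by simp
  rw [h, map_add, fderiv_sqF_base hp, fderiv_sqF_vertical hp, map_neg, gForm_symm fc hp]
  ring

lemma fderiv_fderiv_sqF_horizontal (hp : p ∈ fc.U) (v : Pt n) (u : Fin n → ℝ) :
    fderiv ℝ (fderiv ℝ (sqF fc)) p v (u, -nMap fc p u) =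
      2 * gForm fc p p.2 (fderiv ℝ (nMap fc) p v u) := by
  have hN := ((differentiableAt_nMap hp).hasFDerivAt.clm_apply (hasFDerivAt_const u p)).neg
  have h := (differentiableAt_fderiv_sqF hp).hasFDerivAt.clm_apply
    ((hasFDerivAt_const u p).prodMk hN)
  have hev : (fun q => fderiv ℝ (sqF fc) q (u, -nMap fc q u)) =ᶠ[nhds p] fun _ => 0 := by
    filter_upwards [fc.hUopen.mem_nhds hp] with q hq using fderiv_sqF_horizontal hq u
  have h1 := congrArg (fun l => l v) (h.unique ((hasFDerivAt_const 0 p).congr_of_eventuallyEq hev))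
  simp [fderiv_sqF_vertical hp] at h1
  linarith

/-- The horizontal derivative of the fundamental tensor, contracted with `y`. -/
lemma fderiv_gForm_horizontal (hp : p ∈ fc.U) (u w : Fin n → ℝ) :
    fderiv ℝ (gForm fc) p (u, -nMap fc p u) p.2 w =
      gForm fc p (nMap fc p u) w + gForm fc p p.2 (fderiv ℝ (nMap fc) p (0, w) u) := by
  have h1 := fderiv_fderiv_sqF_horizontal hp (0, w) u
  rw [fderiv_fderiv_sqF_symm hp, fderiv_fderiv_sqF_right_vertical hp] at h1
  simp at h1
  linarith

/-- The curvature of the nonlinear connection is orthogonal to `y`. -/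
lemma gForm_fderiv_nMap_symm (hp : p ∈ fc.U) (u w : Fin n → ℝ) :
    gForm fc p p.2 (fderiv ℝ (nMap fc) p (u, -nMap fc p u) w) =
      gForm fc p p.2 (fderiv ℝ (nMap fc) p (w, -nMap fc p w) u) := by
  have h1 := fderiv_fderiv_sqF_horizontal hp (u, -nMap fc p u) w
  have h2 := fderiv_fderiv_sqF_horizontal hp (w, -nMap fc p w) u
  rw [fderiv_fderiv_sqF_symm hp] at h1
  linarith

lemma fderiv_nMap_apply (hp : p ∈ fc.U) (v : Pt n) (u : Fin n → ℝ) (i : Fin n) :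
    fderiv ℝ (fun q => nMap fc q u i) p v = fderiv ℝ (nMap fc) p v u i := by
  have h := hasFDerivAt_pi'.1
    ((differentiableAt_nMap hp).hasFDerivAt.clm_apply (hasFDerivAt_const u p)) i
  rw [h.fderiv]
  simp

lemma homogOn_N (i j : Fin n) : HomogOn fc.U 1 (fc.N i j) :=
  ((homogOn_spray j).pd_ey fc.hUopen i).congr fun p hp => fc.Ndef i j p hp

lemma fderiv_nMap_liouville (hp : p ∈ fc.U) : fderiv ℝ (nMap fc) p (0, p.2) = nMap fc p := by
  ext u i
  rw [← fderiv_nMap_apply hp]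
  have hh : HomogOn fc.U 1 (fun q => nMap fc q u i) := by
    simp only [nMap_apply]
    exact HomogOn.sum fun j _ => HomogOn.mul (k := 1) (homogOn_N j i) (HomogOn.const _)
  rw [hh.euler fc.hUopen hp (differentiableAt_pi.1 ((differentiableAt_nMap hp).clm_apply
    (differentiableAt_const u)) i)]
  simp

/-- `y^i ∂G_i^j/∂y^k = G_k^j`. -/
lemma fderiv_nMap_vertical (hp : p ∈ fc.U) (w : Fin n → ℝ) :
    fderiv ℝ (nMap fc) p (0, w) p.2 = nMap fc p w := by
  have hl := (differentiableAt_nMap hp).hasFDerivAt.clm_apply (hasFDerivAt_snd (𝕜 := ℝ) (p := p))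
  have hr := (hasFDerivAt_sprayVec hp).const_smul (2 : ℝ)
  have hev : (fun q => nMap fc q q.2) =ᶠ[nhds p] fun q => (2 : ℝ) • sprayVec fc q := by
    filter_upwards [fc.hUopen.mem_nhds hp] with q hq using nMap_liouville hq
  have h := congrArg (fun l => l (0, w)) (hl.unique (hr.congr_of_eventuallyEq hev))
  simp [fderiv_sprayVec_vertical hp, two_smul] at h
  exact h

end FinslerIdentities

section Koszul

/-- The vector field `a^i δ/δx^i + b^i ∂/∂y^i`. -/
def ofParts (a b : Pt n → Fin n → ℝ) : VF n := fun q => (a q, b q - nMap fc q (a q))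

lemma vert_ofParts (a b : Pt n → Fin n → ℝ) (q : Pt n) : vert fc q (ofParts fc a b q) = b q := by
  simp [vert, ofParts]

lemma contDiffOn_ofParts {a b : Pt n → Fin n → ℝ} (ha : ContDiffOn ℝ (⊤ : ℕ∞) a fc.U)
    (hb : ContDiffOn ℝ (⊤ : ℕ∞) b fc.U) : ContDiffOn ℝ (⊤ : ℕ∞) (ofParts fc a b) fc.U :=
  ha.prodMk (hb.sub ((contDiffOn_nMap fc).clm_apply ha))

lemma LV_eq : (LV : VF n) = ofParts fc 0 Prod.snd := by
  funext q
  simp [LV, ofParts]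

lemma XI_eq : XI fc = ofParts fc Prod.snd 0 := by
  funext q
  refine Prod.ext rfl (funext fun j => ?_)
  simp [XI, ofParts, nMap_apply, mul_comm]

lemma vb_eq (E : Fin (n - 1) → Fin n → Pt n → ℝ) (a : Fin (n - 1)) :
    vb E a = ofParts fc 0 (fun q i => E a i q) := by
  funext q
  simp [vb, ofParts]

lemma hb_eq (E : Fin (n - 1) → Fin n → Pt n → ℝ) (a : Fin (n - 1)) :
    hb fc E a = ofParts fc (fun q i => E a i q) 0 := by
  funext q
  refine Prod.ext (funext fun i => ?_) (funext fun j => ?_)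
  · simp [hb, Jm, vb, ofParts, dely]
  · simp [hb, Jm, vb, ofParts, dely, nMap_apply, mul_comm]

variable {fc} {p : Pt n} {a b c d : Pt n → Fin n → ℝ}

lemma fderiv_ofParts (hp : p ∈ fc.U) (ha : DifferentiableAt ℝ a p) (hb : DifferentiableAt ℝ b p)
    (v : Pt n) : fderiv ℝ (ofParts fc a b) p v =
      (fderiv ℝ a p v,
        fderiv ℝ b p v - (nMap fc p (fderiv ℝ a p v) + fderiv ℝ (nMap fc) p v (a p))) := by
  have h : HasFDerivAt (ofParts fc a b) _ p := ha.hasFDerivAt.prodMk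
    (hb.hasFDerivAt.sub ((differentiableAt_nMap hp).hasFDerivAt.clm_apply ha.hasFDerivAt))
  rw [h.fderiv]
  simp

lemma lie_ofParts_fst (hp : p ∈ fc.U) (ha : DifferentiableAt ℝ a p) (hb : DifferentiableAt ℝ b p)
    (hc : DifferentiableAt ℝ c p) (hd : DifferentiableAt ℝ d p) :
    (lie (ofParts fc a b) (ofParts fc c d) p).1 =
      fderiv ℝ c p (ofParts fc a b p) - fderiv ℝ a p (ofParts fc c d p) := by
  simp [lie, fderiv_ofParts hp, ha, hb, hc, hd]

lemma vert_lie_ofParts (hp : p ∈ fc.U) (ha : DifferentiableAt ℝ a p)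
    (hb : DifferentiableAt ℝ b p) (hc : DifferentiableAt ℝ c p) (hd : DifferentiableAt ℝ d p) :
    vert fc p (lie (ofParts fc a b) (ofParts fc c d) p) =
      fderiv ℝ d p (ofParts fc a b p) - fderiv ℝ b p (ofParts fc c d p)
        - fderiv ℝ (nMap fc) p (ofParts fc a b p) (c p)
        + fderiv ℝ (nMap fc) p (ofParts fc c d p) (a p) := by
  simp only [vert, lie, fderiv_ofParts hp, ha, hb, hc, hd, Prod.fst_sub, Prod.snd_sub, map_sub]
  abel

lemma fderiv_Gs_ofParts (hp : p ∈ fc.U) (ha : DifferentiableAt ℝ a p)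
    (hb : DifferentiableAt ℝ b p) (hc : DifferentiableAt ℝ c p) (hd : DifferentiableAt ℝ d p)
    (v : Pt n) :
    fderiv ℝ (fun q => Gs fc q (ofParts fc a b q) (ofParts fc c d q)) p v =
      fderiv ℝ (gForm fc) p v (a p) (c p) + gForm fc p (fderiv ℝ a p v) (c p)
        + gForm fc p (a p) (fderiv ℝ c p v)
        + (fderiv ℝ (gForm fc) p v (b p) (d p) + gForm fc p (fderiv ℝ b p v) (d p)
        + gForm fc p (b p) (fderiv ℝ d p v)) := by
  have hg := (differentiableAt_gForm hp).hasFDerivAt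
  have h := ((hg.clm_apply ha.hasFDerivAt).clm_apply hc.hasFDerivAt).add
    ((hg.clm_apply hb.hasFDerivAt).clm_apply hd.hasFDerivAt)
  have he : (fun q => Gs fc q (ofParts fc a b q) (ofParts fc c d q)) =
      (fun q => gForm fc q (a q) (c q)) + fun q => gForm fc q (b q) (d q) := by
    funext q
    rw [Gs_eq, vert_ofParts, vert_ofParts]
    rfl
  rw [he, h.fderiv]
  simp
  ring

/-- The Koszul formula in terms of horizontal and vertical components, tested against
the vector field with constant components `(s, t)`. -/
lemma koszul_ofParts {nab : VF n → VF n → VF n} (hnab : IsLeviCivita fc nab) (hp : p ∈ fc.U)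
    (ha : ContDiffOn ℝ (⊤ : ℕ∞) a fc.U) (hb : ContDiffOn ℝ (⊤ : ℕ∞) b fc.U)
    (hc : ContDiffOn ℝ (⊤ : ℕ∞) c fc.U) (hd : ContDiffOn ℝ (⊤ : ℕ∞) d fc.U)
    (s t : Fin n → ℝ) {X Y Z : Pt n} (hX : X = (a p, b p - nMap fc p (a p)))
    (hY : Y = (c p, d p - nMap fc p (c p))) (hZ : Z = (s, t - nMap fc p s)) :
    2 * (gForm fc p (nab (ofParts fc a b) (ofParts fc c d) p).1 s
        + gForm fc p (vert fc p (nab (ofParts fc a b) (ofParts fc c d) p)) t) =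
      fderiv ℝ (gForm fc) p X (c p) s + fderiv ℝ (gForm fc) p X (d p) t
      + fderiv ℝ (gForm fc) p Y (a p) s + fderiv ℝ (gForm fc) p Y (b p) t
      - fderiv ℝ (gForm fc) p Z (a p) (c p) - fderiv ℝ (gForm fc) p Z (b p) (d p)
      + 2 * gForm fc p (fderiv ℝ c p X) s + 2 * gForm fc p (fderiv ℝ d p X) t
      + gForm fc p (d p) (fderiv ℝ (nMap fc) p X s) - gForm fc p (d p) (fderiv ℝ (nMap fc) p Z (a p))
      + gForm fc p (b p) (fderiv ℝ (nMap fc) p Y s) - gForm fc p (b p) (fderiv ℝ (nMap fc) p Z (c p))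
      + gForm fc p (fderiv ℝ (nMap fc) p Y (a p)) t
      - gForm fc p (fderiv ℝ (nMap fc) p X (c p)) t := by
  have diff : ∀ {f : Pt n → Fin n → ℝ}, ContDiffOn ℝ (⊤ : ℕ∞) f fc.U → DifferentiableAt ℝ f p :=
    fun h => (h.contDiffAt (fc.hUopen.mem_nhds hp)).differentiableAt (by simp)
  have hs : DifferentiableAt ℝ (fun _ : Pt n => s) p := differentiableAt_const s
  have ht : DifferentiableAt ℝ (fun _ : Pt n => t) p := differentiableAt_const t
  have h := hnab (ofParts fc a b) (ofParts fc c d) (ofParts fc (fun _ => s) (fun _ => t))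
    (contDiffOn_ofParts fc ha hb) (contDiffOn_ofParts fc hc hd)
    (contDiffOn_ofParts fc contDiffOn_const contDiffOn_const) p hp
  have hX' : ofParts fc a b p = X := hX.symm
  have hY' : ofParts fc c d p = Y := hY.symm
  have hZ' : ofParts fc (fun _ => s) (fun _ => t) p = Z := hZ.symm
  simp only [Dv] at h
  rw [fderiv_Gs_ofParts hp (diff ha) (diff hb) (diff hc) (diff hd),
    fderiv_Gs_ofParts hp (diff ha) (diff hb) hs ht,
    fderiv_Gs_ofParts hp (diff hc) (diff hd) hs ht] at h
  simp only [Gs_eq, vert_ofParts] at h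
  rw [lie_ofParts_fst hp (diff ha) (diff hb) (diff hc) (diff hd),
    lie_ofParts_fst hp (diff ha) (diff hb) hs ht, lie_ofParts_fst hp (diff hc) (diff hd) hs ht,
    vert_lie_ofParts hp (diff ha) (diff hb) (diff hc) (diff hd),
    vert_lie_ofParts hp (diff ha) (diff hb) hs ht,
    vert_lie_ofParts hp (diff hc) (diff hd) hs ht, hX', hY', hZ'] at h
  have e1 : (ofParts fc a b p).1 = a p := rfl
  have e2 : (ofParts fc c d p).1 = c p := rfl
  have e3 : (ofParts fc (fun _ => s) (fun _ => t) p).1 = s := rfl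
  rw [← hX', ← hY', ← hZ', e1, e2, e3, hX', hY', hZ'] at h
  simp only [fderiv_fun_const, Pi.zero_apply, _root_.zero_apply, map_add, map_sub, map_zero,
    _root_.add_apply, _root_.sub_apply, zero_sub, map_neg, _root_.neg_apply] at h
  have sy := gForm_symm fc hp
  rw [sy (fderiv ℝ a p Z) (c p), sy (fderiv ℝ b p Z) (d p)] at h
  rw [sy (d p) (fderiv ℝ (nMap fc) p X s), sy (d p) (fderiv ℝ (nMap fc) p Z (a p)),
    sy (b p) (fderiv ℝ (nMap fc) p Y s), sy (b p) (fderiv ℝ (nMap fc) p Z (c p))]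
  rw [sy (a p) (fderiv ℝ c p Z), sy (b p) (fderiv ℝ d p Z), sy (c p) (fderiv ℝ a p Z),
    sy (d p) (fderiv ℝ b p Z)] at h
  linarith

lemma eq_of_gForm_eq (hp : p ∈ fc.U) {u v : Fin n → ℝ}
    (h : ∀ s, gForm fc p u s = gForm fc p v s) : u = v := by
  by_contra hne
  have h1 := gForm_pos fc hp (sub_ne_zero.2 hne)
  have h2 := h (u - v)
  simp only [map_sub, _root_.sub_apply] at h1 h2
  linarith

/-- A tangent vector is determined by its `G`-products. -/
lemma eq_of_gForm_parts (hp : p ∈ fc.U) {v : Pt n} {x y : Fin n → ℝ}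
    (h : ∀ s t, 2 * (gForm fc p v.1 s + gForm fc p (vert fc p v) t) =
      2 * (gForm fc p x s + gForm fc p y t)) : v = (x, y - nMap fc p x) := by
  have h1 : v.1 = x := eq_of_gForm_eq hp fun s => by simpa using h s 0
  have h2 : vert fc p v = y := eq_of_gForm_eq hp fun t => by simpa using h 0 t
  refine Prod.ext h1 ?_
  rw [← h2, ← h1]
  simp [vert]

end Koszul

section Components

variable {fc} {p : Pt n} {nab : VF n → VF n → VF n}

lemma fderiv_gForm_split (s t : Fin n → ℝ) :
    fderiv ℝ (gForm fc) p (s, t - nMap fc p s) =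
      fderiv ℝ (gForm fc) p (s, -nMap fc p s) + fderiv ℝ (gForm fc) p (0, t) := by
  rw [← map_add]
  simp [neg_add_eq_sub]

lemma fderiv_nMap_split (s t : Fin n → ℝ) :
    fderiv ℝ (nMap fc) p (s, t - nMap fc p s) =
      fderiv ℝ (nMap fc) p (s, -nMap fc p s) + fderiv ℝ (nMap fc) p (0, t) := by
  rw [← map_add]
  simp [neg_add_eq_sub]

lemma contDiffOn_zero : ContDiffOn ℝ (⊤ : ℕ∞) (0 : Pt n → Fin n → ℝ) fc.U := contDiffOn_const

lemma contDiffOn_fibre :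
    ContDiffOn ℝ (⊤ : ℕ∞) (Prod.snd : Pt n → Fin n → ℝ) fc.U := contDiffOn_snd

lemma nab_LV_LV (hnab : IsLeviCivita fc nab) (hp : p ∈ fc.U) : nab LV LV p = LV p := by
  have key : nab LV LV p = (0, p.2 - nMap fc p 0) := by
    refine eq_of_gForm_parts hp fun s t => ?_
    rw [LV_eq fc, koszul_ofParts hnab hp contDiffOn_zero contDiffOn_fibre contDiffOn_zero
      contDiffOn_fibre s t (X := (0, p.2)) (Y := (0, p.2)) (by simp) (by simp) rfl,
      fderiv_gForm_split, fderiv_nMap_split]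
    have h := fderiv_gForm_horizontal hp s p.2
    rw [fderiv_nMap_liouville hp, gForm_symm fc hp _ p.2] at h
    simp [fderiv_gForm_liouville hp, fderiv_gForm_vertical hp, fderiv_nMap_liouville hp, fderiv_snd,
      h]
    ring
  rw [key]
  simp [LV]

lemma nab_XI_LV (hnab : IsLeviCivita fc nab) (hp : p ∈ fc.U) : nab (XI fc) LV p = 0 := by
  have key : nab (XI fc) LV p = (0, 0 - nMap fc p 0) := by
    refine eq_of_gForm_parts hp fun s t => ?_
    rw [LV_eq fc, XI_eq fc, koszul_ofParts hnab hp contDiffOn_fibre contDiffOn_zero contDiffOn_zero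
      contDiffOn_fibre s t (X := (p.2, -nMap fc p p.2)) (Y := (0, p.2)) (by simp) (by simp) rfl,
      fderiv_gForm_split, fderiv_nMap_split]
    have h := fderiv_gForm_horizontal hp p.2 t
    have h2 := gForm_fderiv_nMap_symm hp p.2 s
    rw [fderiv_nMap_vertical hp] at h
    simp [fderiv_gForm_liouville hp, fderiv_nMap_liouville hp, fderiv_snd,
      fderiv_nMap_vertical hp, h, h2]
    ring
  rw [key]
  simp

lemma nab_LV_XI (hnab : IsLeviCivita fc nab) (hp : p ∈ fc.U) : nab LV (XI fc) p = XI fc p := by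
  have key : nab LV (XI fc) p = (p.2, 0 - nMap fc p p.2) := by
    refine eq_of_gForm_parts hp fun s t => ?_
    rw [LV_eq fc, XI_eq fc, koszul_ofParts hnab hp contDiffOn_zero contDiffOn_fibre
      contDiffOn_fibre contDiffOn_zero s t (X := (0, p.2)) (Y := (p.2, -nMap fc p p.2))
      (by simp) (by simp) rfl,
      fderiv_gForm_split, fderiv_nMap_split]
    have h := fderiv_gForm_horizontal hp p.2 t
    have h2 := gForm_fderiv_nMap_symm hp p.2 s
    rw [fderiv_nMap_vertical hp] at h
    simp [fderiv_gForm_liouville hp, fderiv_nMap_liouville hp, fderiv_snd,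
      fderiv_nMap_vertical hp, h, h2]
    ring
  rw [key, XI_eq fc]
  rfl

lemma nab_XI_XI (hnab : IsLeviCivita fc nab) (hp : p ∈ fc.U) : nab (XI fc) (XI fc) p = 0 := by
  have key : nab (XI fc) (XI fc) p = (0, 0 - nMap fc p 0) := by
    refine eq_of_gForm_parts hp fun s t => ?_
    rw [XI_eq fc, koszul_ofParts hnab hp contDiffOn_fibre contDiffOn_zero
      contDiffOn_fibre contDiffOn_zero s t (X := (p.2, -nMap fc p p.2))
      (Y := (p.2, -nMap fc p p.2)) (by simp) (by simp) rfl,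
      fderiv_gForm_split, fderiv_nMap_split]
    have h := fderiv_gForm_horizontal hp p.2 s
    have h2 := fderiv_gForm_horizontal hp s p.2
    rw [fderiv_nMap_vertical hp] at h
    rw [fderiv_nMap_liouville hp, gForm_symm fc hp _ p.2] at h2
    simp [fderiv_gForm_vertical hp, fderiv_snd, h, h2]
    ring
  rw [key]
  simp

lemma nab_horizontal_LV (hnab : IsLeviCivita fc nab) (hp : p ∈ fc.U) {e : Pt n → Fin n → ℝ}
    (he : ContDiffOn ℝ (⊤ : ℕ∞) e fc.U) : nab (ofParts fc e 0) LV p = 0 := by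
  have key : nab (ofParts fc e 0) LV p = (0, 0 - nMap fc p 0) := by
    refine eq_of_gForm_parts hp fun s t => ?_
    rw [LV_eq fc, koszul_ofParts hnab hp he contDiffOn_zero contDiffOn_zero
      contDiffOn_fibre s t (X := (e p, -nMap fc p (e p))) (Y := (0, p.2)) (by simp) (by simp) rfl,
      fderiv_gForm_split, fderiv_nMap_split]
    have h := fderiv_gForm_horizontal hp (e p) t
    have h2 := gForm_fderiv_nMap_symm hp (e p) s
    simp [fderiv_gForm_liouville hp, fderiv_nMap_liouville hp, fderiv_snd, h, h2]
    ring
  rw [key]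
  simp

lemma nab_LV_horizontal (hnab : IsLeviCivita fc nab) (hp : p ∈ fc.U) {e : Pt n → Fin n → ℝ}
    (he : ContDiffOn ℝ (⊤ : ℕ∞) e fc.U) :
    nab LV (ofParts fc e 0) p =
      (fderiv ℝ e p (0, p.2), -nMap fc p (fderiv ℝ e p (0, p.2))) := by
  have key : nab LV (ofParts fc e 0) p =
      (fderiv ℝ e p (0, p.2), 0 - nMap fc p (fderiv ℝ e p (0, p.2))) := by
    refine eq_of_gForm_parts hp fun s t => ?_
    rw [LV_eq fc, koszul_ofParts hnab hp contDiffOn_zero contDiffOn_fibre he contDiffOn_zero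
      s t (X := (0, p.2)) (Y := (e p, -nMap fc p (e p))) (by simp) (by simp) rfl,
      fderiv_gForm_split, fderiv_nMap_split]
    have h := fderiv_gForm_horizontal hp (e p) t
    have h2 := gForm_fderiv_nMap_symm hp (e p) s
    simp [fderiv_gForm_liouville hp, fderiv_nMap_liouville hp, h, h2]
    ring
  simpa using key

/-- The derivative of the orthogonality relation between a vertical field and `L`. -/
lemma gForm_fderiv_of_orthogonal {e : Pt n → Fin n → ℝ} (hp : p ∈ fc.U)
    (he : DifferentiableAt ℝ e p) (h0 : ∀ q ∈ fc.U, gForm fc q (e q) q.2 = 0) (w : Fin n → ℝ) :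
    gForm fc p (fderiv ℝ e p (0, w)) p.2 = -gForm fc p (e p) w := by
  have h := (((differentiableAt_gForm hp).hasFDerivAt.clm_apply he.hasFDerivAt).clm_apply
    (hasFDerivAt_snd (𝕜 := ℝ) (p := p)))
  have hev : (fun q => gForm fc q (e q) q.2) =ᶠ[nhds p] fun _ => 0 := by
    filter_upwards [fc.hUopen.mem_nhds hp] with q hq using h0 q hq
  have h1 := congrArg (fun l => l (0, w))
    (h.unique ((hasFDerivAt_const 0 p).congr_of_eventuallyEq hev))
  have h2 := fderiv_gForm_vertical hp w (e p)
  rw [fderiv_gForm_symm hp] at h2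
  simp [h2] at h1
  linarith

lemma gForm_nab_vertical_LV (hnab : IsLeviCivita fc nab) (hp : p ∈ fc.U)
    {e f : Pt n → Fin n → ℝ} (he : ContDiffOn ℝ (⊤ : ℕ∞) e fc.U)
    (hf : ContDiffOn ℝ (⊤ : ℕ∞) f fc.U)
    (hf0 : ∀ q ∈ fc.U, gForm fc q (f q) q.2 = 0) :
    Gs fc p (nab (ofParts fc 0 e) (ofParts fc 0 f) p) (LV p) = -gForm fc p (e p) (f p) := by
  have h := koszul_ofParts hnab hp contDiffOn_zero he contDiffOn_zero hf
      0 p.2 (X := (0, e p)) (Y := (0, f p)) (Z := (0, p.2)) (by simp) (by simp) (by simp)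
  have hv : vert fc p (LV p) = p.2 := by simp [vert, LV]
  have ho := gForm_fderiv_of_orthogonal hp
    ((hf.contDiffAt (fc.hUopen.mem_nhds hp)).differentiableAt (by simp)) hf0 (e p)
  have h1 := fderiv_gForm_vertical hp (e p) (f p)
  have h2 := fderiv_gForm_vertical hp (f p) (e p)
  rw [fderiv_gForm_symm hp] at h1 h2
  simp [h1, h2, fderiv_gForm_liouville hp, ho] at h
  rw [Gs_eq, hv, gForm_symm fc hp (e p)]
  simp [LV]
  linarith

end Components

section AdaptedFrame

variable {fc} {p : Pt n} {E : Fin (n - 1) → Fin n → Pt n → ℝ}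

lemma gb_eq (a b : Fin (n - 1)) :
    gb fc E p a b = gForm fc p (fun i => E a i p) (fun i => E b i p) := by
  simp only [gb, gForm_apply, mul_assoc]

lemma IsAdaptedFrame.contDiffOn (hE : IsAdaptedFrame fc E) (a : Fin (n - 1)) :
    ContDiffOn ℝ (⊤ : ℕ∞) (fun q i => E a i q) fc.U :=
  contDiffOn_pi.2 fun i => hE.1 a i

lemma IsAdaptedFrame.orthogonal (hE : IsAdaptedFrame fc E) (a : Fin (n - 1)) (hp : p ∈ fc.U) :
    gForm fc p (fun i => E a i p) p.2 = 0 := by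
  have h := hE.2.2 a p hp
  rw [vb_eq fc, LV_eq fc, Gs_eq, vert_ofParts, vert_ofParts] at h
  simpa [ofParts] using h

/-- The frame spans the orthogonal complement of `y`. -/
lemma IsAdaptedFrame.mem_span (hE : IsAdaptedFrame fc E) (hp : p ∈ fc.U) {w : Fin n → ℝ}
    (hw : gForm fc p w p.2 = 0) :
    w ∈ Submodule.span ℝ (Set.range fun a : Fin (n - 1) => fun i => E a i p) := by
  let l : Module.Dual ℝ (Fin n → ℝ) := (gForm fc p p.2 : (Fin n → ℝ) →ₗ[ℝ] ℝ)
  have hl : l ≠ 0 := fun h =>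
    (gForm_pos fc hp (fc.hUslit p hp)).ne' (LinearMap.congr_fun h p.2)
  have hle : Submodule.span ℝ (Set.range fun a : Fin (n - 1) => fun i => E a i p) ≤
      LinearMap.ker l := by
    rw [Submodule.span_le]
    rintro _ ⟨a, rfl⟩
    exact (gForm_symm fc hp _ _).trans (hE.orthogonal a hp)
  have hdim : Module.finrank ℝ
      (Submodule.span ℝ (Set.range fun a : Fin (n - 1) => fun i => E a i p)) =
      Module.finrank ℝ (LinearMap.ker l) := by
    have h := Module.Dual.finrank_ker_add_one_of_ne_zero hl
    rw [Module.finrank_fin_fun] at h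
    rw [finrank_span_eq_card (hE.2.1 p hp), Fintype.card_fin]
    omega
  rw [Submodule.eq_of_le_of_finrank_eq hle hdim]
  exact (gForm_symm fc hp _ _).trans hw

lemma IsAdaptedFrame.isUnit_gbMat (hE : IsAdaptedFrame fc E) (hp : p ∈ fc.U) :
    IsUnit (gbMat fc E p) := by
  rw [Matrix.isUnit_iff_isUnit_det, isUnit_iff_ne_zero]
  intro hdet
  obtain ⟨x, hx, hx0⟩ := Matrix.exists_mulVec_eq_zero_iff.2 hdet
  have hu : ∑ a, x a • (fun i => E a i p) ≠ 0 := fun h =>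
    hx (funext (Fintype.linearIndependent_iff.1 (hE.2.1 p hp) x h))
  refine (gForm_pos fc hp hu).ne' ?_
  calc gForm fc p (∑ a, x a • fun i => E a i p) (∑ a, x a • fun i => E a i p)
      = ∑ a, x a * (gbMat fc E p).mulVec x a := by
        simp only [Matrix.mulVec, dotProduct, gbMat, Matrix.of_apply, gb_eq, map_sum, map_smul,
          _root_.sum_apply, _root_.smul_apply, smul_eq_mul, Finset.mul_sum]
        rw [Finset.sum_comm]
        refine Finset.sum_congr rfl fun a _ => Finset.sum_congr rfl fun b _ => ?_
        ring
    _ = 0 := by simp [hx0]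

/-- Expansion of a vector orthogonal to `y` in the adapted frame. -/
lemma IsAdaptedFrame.expansion (hE : IsAdaptedFrame fc E) (hp : p ∈ fc.U) {w : Fin n → ℝ}
    (hw : gForm fc p w p.2 = 0) :
    ∑ e, (∑ d, gForm fc p w (fun i => E d i p) * gbInv fc E p d e) • (fun i => E e i p) = w := by
  obtain ⟨c, rfl⟩ := (Submodule.mem_span_range_iff_exists_fun ℝ).1 (hE.mem_span hp hw)
  refine Finset.sum_congr rfl fun e _ => congrArg (· • _) ?_
  have h : gbMat fc E p * (gbMat fc E p)⁻¹ = 1 :=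
    Matrix.mul_nonsing_inv _ ((Matrix.isUnit_iff_isUnit_det _).1 (hE.isUnit_gbMat hp))
  calc ∑ d, gForm fc p (∑ a, c a • fun i => E a i p) (fun i => E d i p) * gbInv fc E p d e
      = ∑ a, c a * (gbMat fc E p * (gbMat fc E p)⁻¹) a e := by
        simp only [Matrix.mul_apply, gbMat, Matrix.of_apply, gb_eq, map_sum, map_smul,
          _root_.sum_apply, _root_.smul_apply, smul_eq_mul, Finset.sum_mul, Finset.mul_sum, gbInv]
        rw [Finset.sum_comm]
        simp only [mul_assoc]
    _ = c e := by simp [h, Matrix.one_apply]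

end AdaptedFrame

/-- Components of the Levi-Civita connection `∇` of the
Sasaki metric `G` in the adapted frame: `∇_{δ̄/δ̄x^a} L = 0`,
`∇_L(δ̄/δ̄x^a) = L(E_a^i) E_d^k g_{ik} g^{de} δ̄/δ̄x^e`, `∇_ξ ξ = 0`,
`∇_ξ L = 0`, `∇_L ξ = ξ`, `∇_L L = L`, and the `L`-component of
`∇_{∂̄/∂̄y^a} ∂̄/∂̄y^b` equals `−(1/F²) g_{ab} L`, where
`g_{ab} = g_{ij} E_a^i E_b^j`. -/
theorem levi_civita_components {n : ℕ} (fc : Chart n)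
    (E : Fin (n-1) → Fin n → Pt n → ℝ) (hE : IsAdaptedFrame fc E)
    (nab : VF n → VF n → VF n) (hnab : IsLeviCivita fc nab) :
    ∀ p ∈ fc.U, ∀ a : Fin (n-1),
      (nab (hb fc E a) LV p = 0) ∧
      (nab LV (hb fc E a) p =
        ∑ e, (∑ d, (∑ i, ∑ k, Dv LV (E a i) p * E d k p * fc.g i k p)
            * gbInv fc E p d e) • hb fc E e p) ∧
      (nab (XI fc) (XI fc) p = 0) ∧
      (nab (XI fc) LV p = 0) ∧
      (nab LV (XI fc) p = XI fc p) ∧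
      (nab LV LV p = LV p) ∧
      (∀ b : Fin (n-1),
        projL fc (nab (vb E a) (vb E b)) p
          = (-(1 / fc.F p ^ 2) * gb fc E p a b) • LV p) := by
  intro p hp a
  refine ⟨?_, ?_, nab_XI_XI hnab hp, nab_XI_LV hnab hp, nab_LV_XI hnab hp, nab_LV_LV hnab hp,
    fun b => ?_⟩
  · rw [hb_eq]
    exact nab_horizontal_LV hnab hp (hE.contDiffOn a)
  · have hd : DifferentiableAt ℝ (fun q i => E a i q) p :=
      ((hE.contDiffOn a).contDiffAt (fc.hUopen.mem_nhds hp)).differentiableAt (by simp)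
    rw [hb_eq, nab_LV_horizontal hnab hp (hE.contDiffOn a)]
    set w := fderiv ℝ (fun q i => E a i q) p (0, p.2) with hw
    have hDv : ∀ i, Dv LV (E a i) p = w i := fun i => by
      rw [hw, fderiv_pi fun i => differentiableAt_pi.1 hd i]
      rfl
    have hw0 : gForm fc p w p.2 = 0 := by
      rw [hw, gForm_fderiv_of_orthogonal hp hd (fun q hq => hE.orthogonal a hq) p.2,
        hE.orthogonal a hp, neg_zero]
    have hcoef : ∀ d, ∑ i, ∑ k, Dv LV (E a i) p * E d k p * fc.g i k p =
        gForm fc p w (fun i => E d i p) := fun d => by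
      rw [gForm_apply]
      refine Finset.sum_congr rfl fun i _ => Finset.sum_congr rfl fun k _ => ?_
      rw [hDv]
      ring
    simp only [hcoef]
    have hhb : ∀ e, hb fc E e p = (fun i => E e i p, -nMap fc p (fun i => E e i p)) := fun e => by
      simp [hb_eq, ofParts]
    conv_lhs => rw [← hE.expansion hp hw0]
    simp only [hhb]
    refine Prod.ext ?_ ?_ <;> simp [Prod.fst_sum, Prod.snd_sum]
  · have h := gForm_nab_vertical_LV hnab hp (hE.contDiffOn a) (hE.contDiffOn b)
      (fun q hq => hE.orthogonal b hq)
    have hL : Gs fc p (LV p) (LV p) = fc.F p ^ 2 := by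
      refine Eq.trans ?_ (sqF_eq hp).symm
      simp [Gs_eq, vert, LV]
    rw [projL, vb_eq fc, vb_eq fc, h, hL, gb_eq]
    congr 1
    ring

end FinslerFoliations

end
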